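/- arXiv:2110.08047 — 3 statements merged into one kernel-verified Lean document; each statement's English description precedes it below -/
import Mathlib

section
/- Let I be a set, let (T_i)_{i∈I} and (D_i)_{i∈I} be families of atomic cancellative monoids, and let φ_i: T_i → D_i be a transfer homomorphism for each i ∈ I. Then: (1) the restricted product T̂ = ∏'_{i∈I} T_i is an atomic monoid; (2) the componentwise map φ̂: T̂ → D̂ = ∏'_{i∈I} D_i, (α_i)_i ↦ (φ_i(α_i))_i, is a transfer homomorphism. -/
open scoped ENNReal

namespace Paper

section Factorization

variable {M : Type*}

/-- `a` is an atom (irreducible element) of the monoid `M`. -/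
def IsAtomM [Monoid M] (a : M) : Prop :=
  ¬ IsUnit a ∧ ∀ b c : M, a = b * c → IsUnit b ∨ IsUnit c

/-- `a` has a factorization of length `k`: it is a unit times a product of `k` atoms. -/
def HasLen [Monoid M] (a : M) (k : ℕ) : Prop :=
  ∃ (ε : M) (u : Fin k → M), IsUnit ε ∧ (∀ i, IsAtomM (u i)) ∧
    a = ε * (List.ofFn u).prod

/-- The set of lengths `L(a)` of `a`. -/
def LenSet [Monoid M] (a : M) : Set ℕ := {k | HasLen a k}

/-- A monoid is atomic if every element admits a factorization into atoms. -/
def Atomic (M : Type*) [Monoid M] : Prop := ∀ a : M, ∃ k : ℕ, HasLen a k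

/-- `sup L(a)`, valued in `ℝ≥0∞`. -/
noncomputable def supLen [Monoid M] (a : M) : ℝ≥0∞ :=
  ⨆ k ∈ LenSet a, (k : ℝ≥0∞)

/-- `min L(a)`. -/
noncomputable def minLen [Monoid M] (a : M) : ℕ := sInf (LenSet a)

open Classical in
/-- The elasticity `ρ(a) = sup L(a) / min L(a)` of an element (`1` for units). -/
noncomputable def elastOf [Monoid M] (a : M) : ℝ≥0∞ :=
  if IsUnit a then 1 else supLen a / (minLen a : ℝ≥0∞)

/-- The elasticity `ρ(M) = sup {ρ(a) | a ∈ M}` of a monoid. -/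
noncomputable def elasticity (M : Type*) [Monoid M] : ℝ≥0∞ :=
  ⨆ a : M, elastOf a

/-- The refined elasticity `ρ_k(M) = sup {sup L(a) | min L(a) ≤ k}`. -/
noncomputable def refinedElasticity (M : Type*) [Monoid M] (k : ℕ) : ℝ≥0∞ :=
  ⨆ a : M, ⨆ (_ : minLen a ≤ k), supLen a

/-- The union `U_k(M)` of sets of lengths containing `k`. -/
def lengthUnion (M : Type*) [Monoid M] (k : ℕ) : Set ℕ :=
  {m | ∃ a : M, k ∈ LenSet a ∧ m ∈ LenSet a}

/-- Transfer homomorphism between monoids. -/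
def IsTransferHom {M N : Type*} [Monoid M] [Monoid N] (φ : M →* N) : Prop :=
  (∀ a : M, IsUnit (φ a) ↔ IsUnit a) ∧
  (∀ d : N, ∃ (u v : Nˣ) (a : M), d = ↑u * φ a * ↑v) ∧
  (∀ (a : M) (b₁ b₂ : N), φ a = b₁ * b₂ →
    ∃ (a₁ a₂ : M) (ε : Nˣ), a = a₁ * a₂ ∧ φ a₁ = b₁ * ↑ε ∧ φ a₂ = ↑ε⁻¹ * b₂)

/-- The restricted product `∏'_{i ∈ I} T_i` of a family of monoids: all but finitely
many components are units. -/
def restrictedProd {I : Type*} (T : I → Type*) [∀ i, Monoid (T i)] :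
    Submonoid (∀ i, T i) where
  carrier := {α | {i | ¬ IsUnit (α i)}.Finite}
  one_mem' := by
    have : {i | ¬ IsUnit ((1 : ∀ i, T i) i)} = ∅ := by
      ext i; simp
    simp only [Set.mem_setOf_eq, this]
    exact Set.finite_empty
  mul_mem' := by
    intro a b ha hb
    refine Set.Finite.subset (Set.Finite.union ha hb) ?_
    intro i hi
    by_contra h
    simp only [Set.mem_union, Set.mem_setOf_eq, not_or] at h  -- h : IsUnit (a i) ∧ IsUnit (b i)? no
    exact hi (IsUnit.mul (not_not.mp h.1) (not_not.mp h.2))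

/-- A zero-sumfree sequence over a commutative monoid (written multiplicatively):
no nonempty subsequence has product `1`. -/
def ZeroSumfree {G : Type*} [CommMonoid G] (s : Multiset G) : Prop :=
  ∀ t : Multiset G, t ≤ s → t ≠ 0 → t.prod ≠ 1

/-- The Davenport constant: `1 +` the maximal length of a zero-sumfree sequence. -/
noncomputable def davenport (G : Type*) [CommMonoid G] : ℕ :=
  1 + sSup {n : ℕ | ∃ s : Multiset G, ZeroSumfree s ∧ Multiset.card s = n}

/-- The `T`-block monoid `B_T(G, ι)` over `G` induced by `ι : T → G`: pairs `(S, α)`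
of a sequence `S ∈ F(G)` and `α ∈ T` with `σ(S)·ι(α) = 1`. -/
def blockMonoid {G T : Type*} [CommMonoid G] [Monoid T] (ι : T →* G) :
    Submonoid (Multiplicative (Multiset G) × T) where
  carrier := {x | (Multiplicative.toAdd x.1).prod * ι x.2 = 1}
  one_mem' := by simp
  mul_mem' := by
    intro a b ha hb
    simp only [Set.mem_setOf_eq, Prod.fst_mul, Prod.snd_mul, toAdd_mul, Multiset.prod_add,
      map_mul] at *
    rw [mul_mul_mul_comm, ha, hb, one_mul]

/-- Every right ideal is projective. -/
def IsHereditaryRing (R : Type*) [Ring R] : Prop :=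
  ∀ I : Submodule Rᵐᵒᵖ R, Module.Projective Rᵐᵒᵖ I

end Factorization

end Paper

namespace Paper

theorem fac_of_mul {M : Type*} [CancelMonoid M] {x y : M} (h : IsUnit (x * y)) :
    IsUnit x ∧ IsUnit y := by
  obtain ⟨u, hu⟩ := h
  have h1 : x * (y * ↑u⁻¹) = 1 := by rw [← mul_assoc, ← hu, Units.mul_inv]
  have h2 : (↑u⁻¹ * x) * y = 1 := by rw [mul_assoc, ← hu, Units.inv_mul]
  have h1' : (y * ↑u⁻¹) * x = 1 := by
    apply mul_left_cancel (a := x)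
    rw [← mul_assoc, h1, one_mul, mul_one]
  have h2' : y * (↑u⁻¹ * x) = 1 := by
    apply mul_right_cancel (b := y)
    rw [mul_assoc, h2, one_mul, mul_one]
  exact ⟨⟨⟨x, _, h1, h1'⟩, rfl⟩, ⟨⟨y, _, h2', h2⟩, rfl⟩⟩

section
variable {I : Type*} {T : I → Type*} [∀ i, Monoid (T i)]

theorem rp_mem {a : ∀ i, T i} : a ∈ restrictedProd T ↔ {i | ¬ IsUnit (a i)}.Finite := Iff.rfl

/-- The unit of the restricted product with prescribed unit components. -/
def rpUnit (u : ∀ i, (T i)ˣ) : (restrictedProd T)ˣ where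
  val := ⟨fun i => u i, by rw [rp_mem]; simp⟩
  inv := ⟨fun i => ↑(u i)⁻¹, by rw [rp_mem]; simp⟩
  val_inv := by ext i; simp
  inv_val := by ext i; simp

theorem rp_isUnit {a : restrictedProd T} : IsUnit a ↔ ∀ i, IsUnit (a.1 i) := by
  constructor
  · intro h i
    exact (h.map (restrictedProd T).subtype).map (Pi.evalMonoidHom T i)
  · intro h
    choose u hu using h
    exact ⟨rpUnit u, by ext i; exact hu i⟩

open Classical in
/-- The inclusion of a factor. -/
noncomputable def rpSingle (j : I) : T j →* restrictedProd T :=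
  (MonoidHom.mulSingle T j).codRestrict (restrictedProd T) (by
    intro x
    rw [rp_mem]
    refine (Set.finite_singleton j).subset ?_
    intro i hi
    by_contra h
    apply hi
    have h' : i ≠ j := h
    simp [Pi.mulSingle_eq_of_ne h'])

theorem rpSingle_same (j : I) (x : T j) : (rpSingle (T := T) j x).1 j = x := by
  simp [rpSingle]

open Classical in
theorem rpSingle_ne {i j : I} (h : i ≠ j) (x : T j) : (rpSingle (T := T) j x).1 i = 1 := by
  simp [rpSingle, Pi.mulSingle_eq_of_ne h]
end

theorem hasLen_of_list {M : Type*} [Monoid M] {a ε : M} {l : List M} (hε : IsUnit ε)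
    (hl : ∀ x ∈ l, IsAtomM x) (h : a = ε * l.prod) : ∃ k, HasLen a k :=
  ⟨l.length, ε, l.get, hε, fun i => hl _ (l.get_mem i), by rw [List.ofFn_get]; exact h⟩

theorem list_of_hasLen {M : Type*} [Monoid M] {a : M} (h : ∃ k, HasLen a k) :
    ∃ (ε : M) (l : List M), IsUnit ε ∧ (∀ x ∈ l, IsAtomM x) ∧ a = ε * l.prod := by
  obtain ⟨k, ε, u, hε, hu, h⟩ := h
  refine ⟨ε, List.ofFn u, hε, ?_, h⟩
  intro x hx
  rw [List.mem_ofFn] at hx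
  obtain ⟨i, rfl⟩ := hx
  exact hu i

section
variable {I : Type*} {T : I → Type*} [∀ i, CancelMonoid (T i)]

theorem rpSingle_atom (j : I) {x : T j} (hx : IsAtomM x) :
    IsAtomM (rpSingle (T := T) j x) := by
  constructor
  · intro h
    have := rp_isUnit.1 h j
    rw [rpSingle_same] at this
    exact hx.1 this
  · intro b c h
    have hc : ∀ i, (rpSingle (T := T) j x).1 i = b.1 i * c.1 i := fun i => by rw [h]; rfl
    have hne : ∀ i, i ≠ j → IsUnit (b.1 i) ∧ IsUnit (c.1 i) := fun i hi => by
      apply fac_of_mul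
      rw [← hc, rpSingle_ne hi]
      exact isUnit_one
    have hj := hc j
    rw [rpSingle_same] at hj
    refine (hx.2 _ _ hj).imp ?_ ?_
    · intro hb
      rw [rp_isUnit]
      intro i
      by_cases hi : i = j
      · subst hi; exact hb
      · exact (hne i hi).1
    · intro hb
      rw [rp_isUnit]
      intro i
      by_cases hi : i = j
      · subst hi; exact hb
      · exact (hne i hi).2

open Classical in
theorem rp_fac (hT : ∀ i, Atomic (T i)) (S : Finset I) : ∀ a : restrictedProd T,
    (∀ i, ¬ IsUnit (a.1 i) → i ∈ S) →
    ∃ (ε : restrictedProd T) (l : List (restrictedProd T)),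
      IsUnit ε ∧ (∀ x ∈ l, IsAtomM x) ∧ a = ε * l.prod := by
  induction S using Finset.induction_on with
  | empty =>
    intro a ha
    refine ⟨a, [], ?_, by simp, by simp⟩
    rw [rp_isUnit]
    intro i
    by_contra h
    simpa using ha i h
  | insert j S hj ih =>
    intro a ha
    obtain ⟨e, l', he, hl', hfac⟩ := list_of_hasLen (hT j (a.1 j))
    have hsub : ∀ i, ¬ IsUnit (Function.update a.1 j e i) → i ∈ S := by
      intro i hi
      by_cases hij : i = j
      · subst hij; simp [he] at hi
      · rw [Function.update_of_ne hij] at hi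
        exact (Finset.mem_insert.1 (ha i hi)).resolve_left hij
    obtain ⟨ε, l, hε, hl, h⟩ := ih
      ⟨Function.update a.1 j e, S.finite_toSet.subset hsub⟩ hsub
    refine ⟨ε, l ++ l'.map (rpSingle (T := T) j), hε, ?_, ?_⟩
    · intro x hx
      rcases List.mem_append.1 hx with hx | hx
      · exact hl x hx
      · obtain ⟨y, hy, rfl⟩ := List.mem_map.1 hx
        exact rpSingle_atom j (hl' y hy)
    · rw [List.prod_append, ← mul_assoc, ← h, ← map_list_prod]
      ext i
      change a.1 i = Function.update a.1 j e i * (rpSingle (T := T) j l'.prod).1 i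
      by_cases hij : i = j
      · subst hij
        rw [rpSingle_same, Function.update_self]
        exact hfac
      · rw [rpSingle_ne hij, Function.update_of_ne hij, mul_one]

theorem rp_atomic (hT : ∀ i, Atomic (T i)) : Atomic (restrictedProd T) := by
  intro a
  have hf : {i | ¬ IsUnit (a.1 i)}.Finite := a.2
  obtain ⟨ε, l, hε, hl, h⟩ := rp_fac hT hf.toFinset a (fun i hi => by simpa using hi)
  exact hasLen_of_list hε hl h

end

end Paper

open Paper in
/-- Let `(T_i)_{i∈I}` and `(D_i)_{i∈I}` be families of atomic
cancellative monoids and `φ_i : T_i → D_i` transfer homomorphisms. Then (1) the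
restricted product `T̂ = ∏'_{i∈I} T_i` is atomic, and (2) the componentwise map
`φ̂ : T̂ → D̂` is a transfer homomorphism. -/
theorem restrictedProd_atomic_and_transfer
    {I : Type*} (T D : I → Type*) [∀ i, CancelMonoid (T i)] [∀ i, CancelMonoid (D i)]
    (hT : ∀ i, Atomic (T i)) (hD : ∀ i, Atomic (D i))
    (φ : ∀ i, T i →* D i) (hφ : ∀ i, IsTransferHom (φ i)) :
    Atomic ↥(restrictedProd T) ∧
    ∃ ψ : ↥(restrictedProd T) →* ↥(restrictedProd D),
      (∀ (α : ↥(restrictedProd T)) (i : I),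
        ((ψ α : ∀ i, D i) i) = φ i ((α : ∀ i, T i) i)) ∧
      IsTransferHom ψ := by
  refine ⟨rp_atomic hT, ?_⟩
  let ψ : ↥(restrictedProd T) →* ↥(restrictedProd D) :=
    { toFun := fun α => ⟨fun i => φ i (α.1 i), Set.Finite.subset α.2
        (fun i hi h => hi (h.map (φ i)))⟩
      map_one' := by ext i; exact map_one (φ i)
      map_mul' := fun a b => by ext i; exact map_mul (φ i) (a.1 i) (b.1 i) }
  refine ⟨ψ, fun _ _ => rfl, ?_, ?_, ?_⟩
  · intro a
    rw [rp_isUnit, rp_isUnit]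
    exact forall_congr' fun i => (hφ i).1 (a.1 i)
  · intro d
    choose u v a h using fun i => (hφ i).2.1 (d.1 i)
    refine ⟨rpUnit u, rpUnit v, ⟨a, Set.Finite.subset d.2 ?_⟩, ?_⟩
    · intro i hi hd
      apply hi
      rw [h i] at hd
      exact ((hφ i).1 _).1 (fac_of_mul (fac_of_mul hd).1).2
    · ext i; exact h i
  · intro a b₁ b₂ hab
    have hab' : ∀ i, φ i (a.1 i) = b₁.1 i * b₂.1 i := fun i =>
      congrFun (congrArg Subtype.val hab) i
    choose a₁ a₂ ε h h₁ h₂ using fun i => (hφ i).2.2 _ _ _ (hab' i)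
    refine ⟨⟨a₁, Set.Finite.subset a.2 ?_⟩, ⟨a₂, Set.Finite.subset a.2 ?_⟩, rpUnit ε, ?_, ?_, ?_⟩
    · intro i hi ha
      rw [h i] at ha
      exact hi (fac_of_mul ha).1
    · intro i hi ha
      rw [h i] at ha
      exact hi (fac_of_mul ha).2
    · ext i; exact h i
    · ext i; exact h₁ i
    · ext i; exact h₂ i
end

section
/- Let D_p be a central division algebra over the non-archimedean local field K_p, with unique maximal order Δ_p, and let ϖ be a generator of the maximal ideal of Δ_p. Let B, C ∈ M_m(Δ_p)^• be cancellative matrices with B = C + ϖ^t M for some t ∈ ℕ and M ∈ M_m(Δ_p). Suppose either t > w_p(nrd B), or B has entries in the commutative ring R_p[ϖ] and t > v_p(nrd B). Then C = γB for some γ ∈ M_m(Δ_p)^×. -/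
open scoped ENNReal

namespace Paper

/-- The data of a central division algebra `D` over a non-archimedean local field `K_p`
(a completion of a number field at a finite place), together with its (normalized discrete)
valuations `v` on `K_p` and `w = v ∘ nrd` on `D`, a uniformizer `π` of `R_p`, a generator
`ϖ` of the maximal ideal of the unique maximal order `Δ_p = {x | w x ≥ 0}`, and the
reduced norms of the matrix algebras `M_ι(D)`, characterized via the reduced
characteristic polynomial. -/
structure LocalCSA where
  /-- the local field `K_p` -/
  Kp : Type
  [fieldKp : Field Kp]
  /-- the normalized discrete valuation on `K_p` -/
  v : Kp → ℤ
  v_mul : ∀ x y : Kp, x ≠ 0 → y ≠ 0 → v (x * y) = v x + v y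
  v_add : ∀ x y : Kp, x ≠ 0 → y ≠ 0 → x + y ≠ 0 → min (v x) (v y) ≤ v (x + y)
  v_neg : ∀ x : Kp, v (-x) = v x
  /-- a uniformizer of the valuation ring `R_p` -/
  piK : Kp
  piK_ne : piK ≠ 0
  v_piK : v piK = 1
  /-- `K_p` is complete with respect to `v` -/
  complete : ∀ f : ℕ → Kp,
    (∀ N : ℤ, ∃ M : ℕ, ∀ m n : ℕ, M ≤ m → M ≤ n → f m - f n = 0 ∨ N ≤ v (f m - f n)) →
    ∃ L : Kp, ∀ N : ℤ, ∃ M : ℕ, ∀ m : ℕ, M ≤ m → f m - L = 0 ∨ N ≤ v (f m - L)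
  /-- the central division algebra `D_p` -/
  D : Type
  [divD : DivisionRing D]
  [algD : Algebra Kp D]
  [fdD : FiniteDimensional Kp D]
  centralD : Subalgebra.center Kp D = ⊥
  /-- the degree `d` of `D_p`, so `dim_{K_p} D_p = d²` -/
  d : ℕ
  degD : Module.finrank Kp D = d * d
  /-- the valuation `w = v ∘ nrd` on `D_p` -/
  w : D → ℤ
  w_mul : ∀ x y : D, x ≠ 0 → y ≠ 0 → w (x * y) = w x + w y
  w_add : ∀ x y : D, x ≠ 0 → y ≠ 0 → x + y ≠ 0 → min (w x) (w y) ≤ w (x + y)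
  w_neg : ∀ x : D, w (-x) = w x
  w_algebraMap : ∀ x : Kp, x ≠ 0 → w (algebraMap Kp D x) = d * v x
  w_surj : ∀ k : ℤ, ∃ x : D, x ≠ 0 ∧ w x = k
  /-- a generator `ϖ` of the maximal ideal `𝔓` of `Δ_p` -/
  ϖ : D
  ϖ_ne : ϖ ≠ 0
  w_ϖ : w ϖ = 1
  /-- the reduced norm of the central simple algebra `M_ι(D_p)` over `K_p` -/
  nrd : ∀ {ι : Type} [Fintype ι] [DecidableEq ι], Matrix ι ι D → Kp
  nrd_mul : ∀ {ι : Type} [Fintype ι] [DecidableEq ι] (B C : Matrix ι ι D),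
    nrd (B * C) = nrd B * nrd C
  nrd_one : ∀ {ι : Type} [Fintype ι] [DecidableEq ι], nrd (1 : Matrix ι ι D) = 1
  nrd_charpoly : ∀ {ι : Type} [Fintype ι] [DecidableEq ι] (B : Matrix ι ι D),
    ∃ f : Polynomial Kp, f.Monic ∧ f.natDegree = Fintype.card ι * d ∧
      f ^ (Fintype.card ι * d) = LinearMap.charpoly (LinearMap.mulLeft Kp B) ∧
      nrd B = (-1) ^ (Fintype.card ι * d) * f.coeff 0
  /-- cancellative = nonzero reduced norm = invertible over `M_ι(D_p)` -/
  nrd_unit : ∀ {ι : Type} [Fintype ι] [DecidableEq ι] (B : Matrix ι ι D),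
    nrd B ≠ 0 ↔ IsUnit B
  /-- the reduced norm of a matrix with integral entries is integral -/
  nrd_int : ∀ {ι : Type} [Fintype ι] [DecidableEq ι] (B : Matrix ι ι D),
    (∀ i j, B i j = 0 ∨ 0 ≤ w (B i j)) → nrd B = 0 ∨ 0 ≤ v (nrd B)

attribute [instance] LocalCSA.fieldKp LocalCSA.divD LocalCSA.algD LocalCSA.fdD

namespace LocalCSA

variable (L : LocalCSA)

lemma w_one : L.w 1 = 0 := by
  have h := L.w_mul 1 1 one_ne_zero one_ne_zero
  rw [one_mul] at h
  omega

/-- The unique maximal order `Δ_p = {x ∈ D_p | w(x) ≥ 0}`. -/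
def Delta : Set L.D := {x | x = 0 ∨ 0 ≤ L.w x}

/-- The fractional-power `𝔓^m = {x ∈ D_p | w(x) ≥ m}` of the maximal ideal of `Δ_p`. -/
def Ppow (m : ℤ) : Set L.D := {x | x = 0 ∨ m ≤ L.w x}

lemma Ppow_zero_mem (m : ℤ) : (0 : L.D) ∈ L.Ppow m := Or.inl rfl

lemma Ppow_add_mem {m : ℤ} {x y : L.D} (hx : x ∈ L.Ppow m) (hy : y ∈ L.Ppow m) :
    x + y ∈ L.Ppow m := by
  by_cases hx0 : x = 0
  · subst hx0; simpa using hy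
  by_cases hy0 : y = 0
  · subst hy0; simpa using hx
  by_cases hxy : x + y = 0
  · exact Or.inl hxy
  have hwx : m ≤ L.w x := hx.resolve_left hx0
  have hwy : m ≤ L.w y := hy.resolve_left hy0
  exact Or.inr (le_trans (le_min hwx hwy) (L.w_add x y hx0 hy0 hxy))

lemma Ppow_mul_mem {s t : ℤ} {x y : L.D} (hx : x ∈ L.Ppow s) (hy : y ∈ L.Ppow t) :
    x * y ∈ L.Ppow (s + t) := by
  by_cases hx0 : x = 0
  · exact Or.inl (by simp [hx0])
  by_cases hy0 : y = 0
  · exact Or.inl (by simp [hy0])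
  have hwx : s ≤ L.w x := hx.resolve_left hx0
  have hwy : t ≤ L.w y := hy.resolve_left hy0
  exact Or.inr (by rw [L.w_mul x y hx0 hy0]; omega)

lemma Ppow_neg_mem {m : ℤ} {x : L.D} (hx : x ∈ L.Ppow m) : -x ∈ L.Ppow m := by
  rcases hx with rfl | hx
  · exact Or.inl (by simp)
  · exact Or.inr (by rw [L.w_neg]; exact hx)

lemma Ppow_mono {s t : ℤ} (h : s ≤ t) : L.Ppow t ⊆ L.Ppow s := by
  intro x hx
  rcases hx with rfl | hx
  · exact Or.inl rfl
  · exact Or.inr (le_trans h hx)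

lemma Ppow_one_mem {m : ℤ} (h : m ≤ 0) : (1 : L.D) ∈ L.Ppow m := by
  exact Or.inr (by rw [L.w_one]; exact h)

end LocalCSA

end Paper

namespace Paper

namespace LocalCSA

variable (L : LocalCSA)

/-- The exponent matrix conditions for a tiled order in standard form. -/
def IsStdForm {r : ℕ} (m : Fin r → Fin r → ℤ) : Prop :=
  (∀ i, m i i = 0) ∧ (∀ i j k, m i k ≤ m i j + m j k) ∧ (∀ i j, i ≠ j → 0 < m i j + m j i)

/-- The block index set of the partition `ñ = (n_1, …, n_r)` of `n`: an index in block
`i` is a pair `⟨i, x⟩` with `x ∈ Fin (n_i)`. -/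
abbrev BlockIdx {r : ℕ} (nv : Fin r → ℕ) : Type := (i : Fin r) × Fin (nv i)

/-- The underlying set of the order `O(ñ, M) = ⊕_{i,j} M_{n_i × n_j}(𝔓^{m_{ij}})`,
for matrices indexed by an index set `ι` with block-assignment `β : ι → Fin r`. -/
def stdSet {r : ℕ} (m : Fin r → Fin r → ℤ) {ι : Type} (β : ι → Fin r) :
    Set (Matrix ι ι L.D) :=
  {B | ∀ a b : ι, B a b ∈ L.Ppow (m (β a) (β b))}

/-- The order `O(ñ, M)` as a subring of the matrix algebra. -/
def stdOrder {r : ℕ} (m : Fin r → Fin r → ℤ) {ι : Type} [Fintype ι] [DecidableEq ι]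
    (β : ι → Fin r) (h0 : ∀ i, m i i = 0) (htri : ∀ i j k, m i k ≤ m i j + m j k) :
    Subring (Matrix ι ι L.D) where
  carrier := L.stdSet m β
  zero_mem' := fun a b => by simpa using L.Ppow_zero_mem _
  one_mem' := by
    intro a b
    by_cases h : a = b
    · subst h
      simpa [Matrix.one_apply_eq] using L.Ppow_one_mem (le_of_eq (h0 (β a)))
    · simpa [Matrix.one_apply_ne h] using L.Ppow_zero_mem _
  add_mem' := by
    intro B C hB hC a b
    simpa [Matrix.add_apply] using L.Ppow_add_mem (hB a b) (hC a b)
  neg_mem' := by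
    intro B hB a b
    simpa [Matrix.neg_apply] using L.Ppow_neg_mem (hB a b)
  mul_mem' := by
    intro B C hB hC a b
    rw [Matrix.mul_apply]
    refine Finset.sum_induction _ (· ∈ L.Ppow (m (β a) (β b)))
      (fun x y hx hy => L.Ppow_add_mem hx hy) (L.Ppow_zero_mem _) ?_
    intro c _
    exact L.Ppow_mono (htri (β a) (β c) (β b)) (L.Ppow_mul_mem (hB a c) (hC c b))

/-- The monoid `O^•` of cancellative elements (nonzero reduced norm) of a subring `O`
of a matrix algebra over `D_p`. -/
def matDot {ι : Type} [Fintype ι] [DecidableEq ι] (O : Subring (Matrix ι ι L.D)) :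
    Submonoid (Matrix ι ι L.D) where
  carrier := {B | B ∈ O ∧ L.nrd B ≠ 0}
  one_mem' := ⟨Subring.one_mem O, by rw [L.nrd_one]; exact one_ne_zero⟩
  mul_mem' := by
    intro B C hB hC
    exact ⟨Subring.mul_mem O hB.1 hC.1, by rw [L.nrd_mul]; exact mul_ne_zero hB.2 hC.2⟩

/-- `O` is an `R_p`-order in the algebra `B`: it contains the image of the valuation
ring `R_p = {x | v(x) ≥ 0}`, is finitely generated as an `R_p`-module, and spans `B`
over `K_p`. -/
def IsOrderIn {Kp : Type} [Field Kp] (v : Kp → ℤ) {B : Type} [Ring B] (ψ : Kp →+* B)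
    (O : Subring B) : Prop :=
  (∀ x : Kp, (x = 0 ∨ 0 ≤ v x) → ψ x ∈ O) ∧
  (∃ s : Finset B, ↑s ⊆ (O : Set B) ∧ ∀ b ∈ O, ∃ c : B → Kp,
      (∀ y : B, c y = 0 ∨ 0 ≤ v (c y)) ∧ b = ∑ y ∈ s, ψ (c y) * y) ∧
  (∀ b : B, ∃ x : Kp, x ≠ 0 ∧ ψ x * b ∈ O)

/-- A local order `O ⊆ M_n(D_p)` is tiled if it contains a conjugate of
`Diag(Δ_p, …, Δ_p)`. -/
def IsTiledOrder {n : ℕ} (O : Subring (Matrix (Fin n) (Fin n) L.D)) : Prop :=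
  IsOrderIn L.v (algebraMap L.Kp (Matrix (Fin n) (Fin n) L.D)) O ∧
  ∃ u : (Matrix (Fin n) (Fin n) L.D)ˣ,
    ∀ B : Matrix (Fin n) (Fin n) L.D,
      (∀ i j, (i = j → B i j ∈ L.Delta) ∧ (i ≠ j → B i j = 0)) →
      u.val * B * (u⁻¹).val ∈ O

end LocalCSA

end Paper

namespace Paper

namespace LocalCSA

variable (L : LocalCSA)

section Helpers

lemma v_one' : L.v 1 = 0 := by
  have h := L.v_mul 1 1 one_ne_zero one_ne_zero
  rw [one_mul] at h
  omega

lemma v_pow' (x : L.Kp) (hx : x ≠ 0) (k : ℕ) : L.v (x ^ k) = k * L.v x := by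
  induction k with
  | zero => simp [v_one']
  | succ k ih =>
    rw [pow_succ, L.v_mul _ _ (pow_ne_zero _ hx) hx, ih]
    push_cast; ring

lemma w_pow' (x : L.D) (hx : x ≠ 0) (k : ℕ) : L.w (x ^ k) = k * L.w x := by
  induction k with
  | zero => simp [w_one]
  | succ k ih =>
    rw [pow_succ, L.w_mul _ _ (pow_ne_zero _ hx) hx, ih]
    push_cast; ring

lemma w_inv' (x : L.D) (hx : x ≠ 0) : L.w x⁻¹ = - L.w x := by
  have h := L.w_mul x x⁻¹ hx (inv_ne_zero hx)
  rw [mul_inv_cancel₀ hx, w_one] at h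
  omega

lemma v_neg_one_pow_mul (k : ℕ) (x : L.Kp) : L.v ((-1) ^ k * x) = L.v x := by
  rcases neg_one_pow_eq_or L.Kp k with h | h <;> simp [h, L.v_neg]

lemma d_pos : 0 < L.d := by
  have h : 0 < Module.finrank L.Kp L.D := Module.finrank_pos
  rw [L.degD] at h
  exact Nat.pos_of_mul_pos_left h

variable {n : ℕ}

/-- All entries lie in `𝔓^k`. -/
def InP (k : ℤ) (A : Matrix (Fin n) (Fin n) L.D) : Prop := ∀ i j, A i j ∈ L.Ppow k

variable {L}

lemma sum_mem_Ppow {ι : Type*} (s : Finset ι) (k : ℤ) (f : ι → L.D)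
    (h : ∀ i ∈ s, f i ∈ L.Ppow k) : ∑ i ∈ s, f i ∈ L.Ppow k :=
  Finset.sum_induction _ (· ∈ L.Ppow k)
      (fun _ _ hx hy => L.Ppow_add_mem hx hy) (L.Ppow_zero_mem _) h

lemma InP.mul {a b : ℤ} {A B : Matrix (Fin n) (Fin n) L.D} (hA : L.InP a A) (hB : L.InP b B) :
    L.InP (a + b) (A * B) := by
  intro i j
  rw [Matrix.mul_apply]
  exact sum_mem_Ppow _ _ _ fun c _ => L.Ppow_mul_mem (hA i c) (hB c j)

lemma InP.mono {a b : ℤ} (h : b ≤ a) {A : Matrix (Fin n) (Fin n) L.D} (hA : L.InP a A) :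
    L.InP b A := fun i j => L.Ppow_mono h (hA i j)

lemma InP.add {a : ℤ} {A B : Matrix (Fin n) (Fin n) L.D} (hA : L.InP a A) (hB : L.InP a B) :
    L.InP a (A + B) := fun i j => L.Ppow_add_mem (hA i j) (hB i j)

lemma InP.neg {a : ℤ} {A : Matrix (Fin n) (Fin n) L.D} (hA : L.InP a A) :
    L.InP a (-A) := fun i j => L.Ppow_neg_mem (hA i j)

lemma InP.diagonal {a : ℤ} {f : Fin n → L.D} (h : ∀ i, f i ∈ L.Ppow a) :
    L.InP a (Matrix.diagonal f) := by
  intro i j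
  rw [Matrix.diagonal_apply]
  split_ifs
  · exact h i
  · exact L.Ppow_zero_mem _

lemma InP.one : L.InP 0 (1 : Matrix (Fin n) (Fin n) L.D) := by
  rw [← Matrix.diagonal_one]
  exact InP.diagonal fun _ => L.Ppow_one_mem le_rfl

lemma nrd_ne_of_mul {A B : Matrix (Fin n) (Fin n) L.D} (h : A * B = 1) :
    L.nrd A ≠ 0 ∧ L.nrd B ≠ 0 := by
  have h1 := L.nrd_mul A B
  rw [h, L.nrd_one] at h1
  constructor <;> intro h0 <;> simp [h0] at h1

lemma phi_mul {A B : Matrix (Fin n) (Fin n) L.D} (hA : L.nrd A ≠ 0) (hB : L.nrd B ≠ 0) :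
    L.v (L.nrd (A * B)) = L.v (L.nrd A) + L.v (L.nrd B) := by
  rw [L.nrd_mul, L.v_mul _ _ hA hB]

lemma phi_nonneg {A : Matrix (Fin n) (Fin n) L.D} (hA : L.nrd A ≠ 0) (h : L.InP 0 A) :
    0 ≤ L.v (L.nrd A) := (L.nrd_int A h).resolve_left hA

lemma phi_unit {A B : Matrix (Fin n) (Fin n) L.D} (hA : L.InP 0 A) (hB : L.InP 0 B)
    (h : A * B = 1) : L.v (L.nrd A) = 0 := by
  obtain ⟨h1, h2⟩ := nrd_ne_of_mul h
  have h3 := phi_mul h1 h2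
  rw [h, L.nrd_one, v_one'] at h3
  have := phi_nonneg h1 hA
  have := phi_nonneg h2 hB
  omega

/-- `v(nrd(c·1)) = n d v(c)` for scalars `c`. -/
lemma phi_scalar (hn : 0 < n) (c : L.Kp) (hc : c ≠ 0) :
    L.v (L.nrd (algebraMap L.Kp (Matrix (Fin n) (Fin n) L.D) c)) = n * L.d * L.v c := by
  set A := algebraMap L.Kp (Matrix (Fin n) (Fin n) L.D) c with hA
  have hAne : L.nrd A ≠ 0 := by
    rw [L.nrd_unit]
    exact (IsUnit.mk0 c hc).map _
  obtain ⟨f, -, -, hf, hnrd⟩ := L.nrd_charpoly A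
  have hd := L.d_pos
  have hnd : 0 < n * L.d := Nat.mul_pos hn hd
  rw [Fintype.card_fin] at hf hnrd
  have hf0 : f.coeff 0 ≠ 0 := by
    intro h; rw [h, mul_zero] at hnrd; exact hAne hnrd
  have h1 : L.v (L.nrd A) = L.v (f.coeff 0) := by rw [hnrd, v_neg_one_pow_mul]
  have hlin : LinearMap.mulLeft L.Kp A = c • LinearMap.id := by
    ext1 X
    simp [hA, Algebra.smul_def]
  have hdet : LinearMap.det (LinearMap.mulLeft L.Kp A) = c ^ (n * n * (L.d * L.d)) := by
    rw [hlin, LinearMap.det_smul, LinearMap.det_id, mul_one, Module.finrank_matrix, L.degD]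
    simp
  have h2 : (f.coeff 0) ^ (n * L.d) = (LinearMap.charpoly (LinearMap.mulLeft L.Kp A)).coeff 0 := by
    rw [← hf, Polynomial.coeff_zero_eq_eval_zero, Polynomial.coeff_zero_eq_eval_zero,
      Polynomial.eval_pow]
  rw [LinearMap.det_eq_sign_charpoly_coeff, ← h2] at hdet
  have h3 := congrArg L.v hdet
  rw [v_neg_one_pow_mul, v_pow' _ _ hf0, v_pow' _ _ hc] at h3
  rw [h1]
  have : ((n * L.d : ℕ) : ℤ) ≠ 0 := by exact_mod_cast hnd.ne'
  apply mul_left_cancel₀ this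
  rw [h3]
  push_cast; ring

variable (L) in
/-- The diagonal matrix with `ϖ` at the positions in `s` and `1` elsewhere. -/
noncomputable def Ed (s : Finset (Fin n)) : Matrix (Fin n) (Fin n) L.D :=
  Matrix.diagonal fun i => if i ∈ s then L.ϖ else 1

variable (L) in
/-- The inverse of `Ed s`. -/
noncomputable def Edi (s : Finset (Fin n)) : Matrix (Fin n) (Fin n) L.D :=
  Matrix.diagonal fun i => if i ∈ s then L.ϖ⁻¹ else 1

lemma Ed_mul_Edi (s : Finset (Fin n)) : L.Ed s * L.Edi s = 1 := by
  rw [Ed, Edi, Matrix.diagonal_mul_diagonal, ← Matrix.diagonal_one]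
  congr 1; funext i
  split_ifs <;> simp [L.ϖ_ne]

lemma Edi_mul_Ed (s : Finset (Fin n)) : L.Edi s * L.Ed s = 1 := by
  rw [Ed, Edi, Matrix.diagonal_mul_diagonal, ← Matrix.diagonal_one]
  congr 1; funext i
  split_ifs <;> simp [L.ϖ_ne]

lemma Ed_ne (s : Finset (Fin n)) : L.nrd (L.Ed s) ≠ 0 := (nrd_ne_of_mul (Ed_mul_Edi s)).1

lemma InP_Edi (s : Finset (Fin n)) : L.InP (-1) (L.Edi s) := by
  refine InP.diagonal fun i => ?_
  split_ifs
  · exact Or.inr (by rw [w_inv' _ _ L.ϖ_ne, L.w_ϖ])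
  · exact L.Ppow_one_mem (by norm_num)

lemma phi_Ed_single (a b : Fin n) : L.v (L.nrd (L.Ed {a})) = L.v (L.nrd (L.Ed {b})) := by
  set P : Matrix (Fin n) (Fin n) L.D := (Equiv.swap a b).toPEquiv.toMatrix with hP
  have hPP : P * P = 1 := by
    rw [hP, ← PEquiv.toMatrix_trans, ← Equiv.toPEquiv_trans]
    have : (Equiv.swap a b).trans (Equiv.swap a b) = Equiv.refl _ := by ext; simp
    rw [this]; simp
  have hPi : L.InP 0 P := by
    intro i j
    rw [hP, PEquiv.toMatrix_apply]
    split_ifs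
    · exact L.Ppow_one_mem le_rfl
    · exact L.Ppow_zero_mem _
  have hcomm : P * L.Ed {a} = L.Ed {b} * P := by
    ext i j
    rw [Ed, Ed, Matrix.mul_diagonal, Matrix.diagonal_mul, hP, PEquiv.toMatrix_apply]
    by_cases h : Equiv.swap a b i = j
    · have : j = a ↔ i = b := by
        rw [← h, Equiv.swap_apply_eq_iff]; simp
      simp [this, h]
    · simp [h]
  have h0 := phi_unit hPi hPi hPP
  have hne := (nrd_ne_of_mul hPP).1
  have h1 := phi_mul hne (Ed_ne (L := L) {a})
  rw [hcomm, phi_mul (Ed_ne _) hne] at h1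
  omega

lemma phi_Ed (a : Fin n) (s : Finset (Fin n)) :
    L.v (L.nrd (L.Ed s)) = s.card * L.v (L.nrd (L.Ed {a})) := by
  induction s using Finset.induction_on with
  | empty => simp [Ed, L.nrd_one, v_one']
  | insert b s hb ih =>
    have : L.Ed (insert b s) = L.Ed {b} * L.Ed s := by
      rw [Ed, Ed, Ed, Matrix.diagonal_mul_diagonal]
      congr 1; funext i
      by_cases hi : i = b
      · subst hi; simp [hb]
      · simp [hi]
    rw [this, phi_mul (Ed_ne _) (Ed_ne _), ih, phi_Ed_single b a, Finset.card_insert_of_notMem hb]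
    push_cast; ring

lemma phi_Ed_one (a : Fin n) : L.v (L.nrd (L.Ed {a})) = 1 := by
  have hn : 0 < n := a.pos
  have hd := L.d_pos
  have hG := phi_Ed (L := L) a Finset.univ
  rw [Finset.card_univ, Fintype.card_fin] at hG
  have hGe : L.Ed (Finset.univ : Finset (Fin n)) = Matrix.diagonal fun _ => L.ϖ := by simp [Ed]
  set x := algebraMap L.Kp L.D L.piK with hx
  have hx0 : x ≠ 0 := by rw [hx]; simpa using L.piK_ne
  have hwx : L.w x = L.d := by rw [hx, L.w_algebraMap _ L.piK_ne, L.v_piK, mul_one]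
  have hw : L.w (L.ϖ ^ L.d) = L.d := by rw [w_pow' _ _ L.ϖ_ne, L.w_ϖ, mul_one]
  have hp0 : L.ϖ ^ L.d ≠ 0 := pow_ne_zero _ L.ϖ_ne
  have hu0 : L.ϖ ^ L.d * x⁻¹ ≠ 0 := mul_ne_zero hp0 (inv_ne_zero hx0)
  have hwu : L.w (L.ϖ ^ L.d * x⁻¹) = 0 := by
    rw [L.w_mul _ _ hp0 (inv_ne_zero hx0), w_inv' _ _ hx0]; omega
  set u := L.ϖ ^ L.d * x⁻¹ with hu
  have huu : (Matrix.diagonal fun _ : Fin n => u) * (Matrix.diagonal fun _ => u⁻¹) = 1 := by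
    rw [Matrix.diagonal_mul_diagonal, ← Matrix.diagonal_one]; simp [hu0]
  have hphiu : L.v (L.nrd (Matrix.diagonal fun _ : Fin n => u)) = 0 := by
    refine phi_unit (InP.diagonal fun _ => Or.inr hwu.ge) (InP.diagonal fun _ => Or.inr ?_) huu
    rw [w_inv' _ _ hu0]; omega
  have hxd : algebraMap L.Kp (Matrix (Fin n) (Fin n) L.D) L.piK = Matrix.diagonal fun _ => x := by
    rw [Matrix.algebraMap_eq_diagonal]; rfl
  have hpow : (L.Ed (Finset.univ : Finset (Fin n))) ^ L.d =
      (Matrix.diagonal fun _ => u) * algebraMap L.Kp (Matrix (Fin n) (Fin n) L.D) L.piK := by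
    rw [hGe, hxd, Matrix.diagonal_pow, Matrix.diagonal_mul_diagonal]
    congr 1; funext i
    simp [hu, hx0]
  have hpi : L.nrd (algebraMap L.Kp (Matrix (Fin n) (Fin n) L.D) L.piK) ≠ 0 := by
    rw [L.nrd_unit]
    exact (IsUnit.mk0 _ L.piK_ne).map _
  have hnp : ∀ (A : Matrix (Fin n) (Fin n) L.D) (k : ℕ), L.nrd (A ^ k) = L.nrd A ^ k := by
    intro A k
    induction k with
    | zero => simp [L.nrd_one]
    | succ k ih => rw [pow_succ, L.nrd_mul, ih, pow_succ]
  have h := congrArg (fun A => L.v (L.nrd A)) hpow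
  rw [phi_mul (nrd_ne_of_mul huu).1 hpi, hphiu, phi_scalar hn _ L.piK_ne, L.v_piK, hnp,
    v_pow' _ _ (Ed_ne _), hG] at h
  have : ((n * L.d : ℕ) : ℤ) ≠ 0 := by exact_mod_cast (Nat.mul_pos hn hd).ne'
  apply mul_left_cancel₀ this
  push_cast
  linarith

/-- In a row with a non-integral entry there is a nonzero entry of minimal (negative) value. -/
lemma exists_min_entry {A : Matrix (Fin n) (Fin n) L.D} (h : ¬ L.InP 0 A) :
    ∃ i j, A i j ≠ 0 ∧ L.w (A i j) < 0 ∧ ∀ k, A i k ∈ L.Ppow (L.w (A i j)) := by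
  classical
  simp only [InP, not_forall] at h
  obtain ⟨i, j₀, hj₀⟩ := h
  have hj : A i j₀ ≠ 0 ∧ L.w (A i j₀) < 0 := by
    constructor
    · intro h; exact hj₀ (Or.inl h)
    · by_contra h; exact hj₀ (Or.inr (not_lt.mp h))
  obtain ⟨j, hjm, hmin⟩ := Finset.exists_min_image (Finset.univ.filter fun j => A i j ≠ 0)
    (fun j => L.w (A i j)) ⟨j₀, by simp [hj.1]⟩
  simp only [Finset.mem_filter, Finset.mem_univ, true_and] at hjm hmin
  refine ⟨i, j, hjm, lt_of_le_of_lt (hmin j₀ hj.1) hj.2, fun k => ?_⟩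
  by_cases hk : A i k = 0
  · exact Or.inl hk
  · exact Or.inr (hmin k hk)

/-- The inverse of an integral matrix `B` has entries in `𝔓^{-v(nrd B)}`. -/
lemma inv_bound (N : ℕ) : ∀ (A B : Matrix (Fin n) (Fin n) L.D), A * B = 1 → B * A = 1 →
    L.InP 0 B → L.v (L.nrd B) < N → L.InP (-L.v (L.nrd B)) A := by
  induction N with
  | zero =>
    intro A B hAB hBA hB hN
    have := phi_nonneg (nrd_ne_of_mul hBA).1 hB
    push_cast at hN
    omega
  | succ N ih =>
    intro A B hAB hBA hB hN
    have hBne := (nrd_ne_of_mul hBA).1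
    have hBnn := phi_nonneg hBne hB
    by_cases hA : L.InP 0 A
    · exact hA.mono (by omega)
    obtain ⟨i, j, hne, hneg, hmin⟩ := exists_min_entry hA
    have hwi : L.w (A i j)⁻¹ = - L.w (A i j) := w_inv' _ _ hne
    set S : Matrix (Fin n) (Fin n) L.D := Matrix.of fun a b =>
      if a = j then (if b = j then 0 else (A i j)⁻¹ * A i b) else 0 with hS
    have hSS : S * S = 0 := by
      ext a b
      rw [Matrix.mul_apply, Matrix.zero_apply]
      refine Finset.sum_eq_zero fun c _ => ?_
      by_cases hc : c = j <;> simp [hS, hc]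
    have hSi : L.InP 0 S := by
      intro a b
      simp only [hS, Matrix.of_apply]
      split_ifs
      · exact L.Ppow_zero_mem _
      · have := L.Ppow_mul_mem (x := (A i j)⁻¹) (s := - L.w (A i j)) (Or.inr hwi.ge) (hmin b)
        simpa using this
      · exact L.Ppow_zero_mem _
    have hU1 : (1 + S) * (1 - S) = 1 := by
      rw [add_mul, mul_sub, mul_sub, hSS]; simp
    have hU2 : (1 - S) * (1 + S) = 1 := by
      rw [sub_mul, mul_add, mul_add, hSS]; simp
    have hUi : L.InP 0 (1 + S) := InP.one.add hSi
    have hVi : L.InP 0 (1 - S) := by rw [sub_eq_add_neg]; exact InP.one.add hSi.neg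
    have hUB : ∀ b, ((1 + S) * B) j b = (A i j)⁻¹ * (1 : Matrix (Fin n) (Fin n) L.D) i b := by
      intro b
      rw [← hAB, Matrix.mul_apply, Matrix.mul_apply, Finset.mul_sum]
      refine Finset.sum_congr rfl fun c _ => ?_
      rw [← mul_assoc]
      congr 1
      by_cases hc : c = j
      · subst hc; simp [hS, hne, hAB]
      · simp [hS, hc, hAB, Matrix.one_apply_ne (Ne.symm hc)]
    have hUBi : L.InP 0 ((1 + S) * B) := by simpa using hUi.mul hB
    have hB'i : L.InP 0 (L.Edi {j} * ((1 + S) * B)) := by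
      intro a b
      rw [Edi, Matrix.diagonal_mul]
      by_cases ha : a = j
      · subst ha
        rw [hUB]
        simp only [Finset.mem_singleton, if_true]
        have h1 : L.ϖ⁻¹ ∈ L.Ppow (-1) := Or.inr (by rw [w_inv' _ _ L.ϖ_ne, L.w_ϖ])
        have h2 : (A i a)⁻¹ ∈ L.Ppow 1 := Or.inr (by omega)
        simpa using L.Ppow_mul_mem h1 (L.Ppow_mul_mem h2 (InP.one i b))
      · simpa [ha] using hUBi a b
    set B' := L.Edi {j} * ((1 + S) * B) with hB'
    have hBeq : (1 + S) * B = L.Ed {j} * B' := by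
      rw [hB', ← mul_assoc, Ed_mul_Edi, one_mul]
    set A' := A * (1 - S) * L.Ed {j} with hA'
    have hB'A' : B' * A' = 1 := by
      calc B' * A' = L.Edi {j} * ((1 + S) * (B * A) * (1 - S)) * L.Ed {j} := by
            rw [hB', hA']; simp only [mul_assoc]
        _ = 1 := by rw [hBA, mul_one, hU1, mul_one, Edi_mul_Ed]
    have hA'B' : A' * B' = 1 := by
      calc A' * B' = A * ((1 - S) * ((L.Ed {j} * L.Edi {j}) * ((1 + S) * B))) := by
            rw [hB', hA']; simp only [mul_assoc]
        _ = A * (((1 - S) * (1 + S)) * B) := by rw [Ed_mul_Edi, one_mul, mul_assoc (1 - S)]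
        _ = 1 := by rw [hU2, one_mul, hAB]
    have hphi := congrArg (fun X => L.v (L.nrd X)) hBeq
    rw [phi_mul (nrd_ne_of_mul hU1).1 hBne, phi_mul (Ed_ne _) (nrd_ne_of_mul hB'A').1,
      phi_unit hUi hVi hU1, phi_Ed_one] at hphi
    have hrec := ih A' B' hA'B' hB'A' hB'i (by push_cast at hN; omega)
    have hAeq : A = A' * L.Edi {j} * (1 + S) := by
      calc A = A * ((1 - S) * (1 + S)) := by rw [hU2, mul_one]
        _ = A * ((1 - S) * ((L.Ed {j} * L.Edi {j}) * (1 + S))) := by rw [Ed_mul_Edi, one_mul]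
        _ = _ := by rw [hA']; simp only [mul_assoc]
    rw [hAeq]
    exact ((hrec.mul (InP_Edi {j})).mul hUi).mono (by omega)

/-- If `G = 1 - N` with `N ≡ 0 mod 𝔓` is invertible over `D`, its inverse is integral. -/
lemma inv_one_sub {A N : Matrix (Fin n) (Fin n) L.D} (hN : L.InP 1 N) (h : A * (1 - N) = 1) :
    L.InP 0 A := by
  by_contra hA
  obtain ⟨i, j, hne, hneg, hmin⟩ := exists_min_entry hA
  have hA' : A = 1 + A * N := by
    rw [mul_sub, mul_one] at h
    rw [← h]; simp
  have h1 : A i j ∈ L.Ppow (L.w (A i j) + 1) := by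
    have h2 : (1 + A * N) i j ∈ L.Ppow (L.w (A i j) + 1) := by
      rw [Matrix.add_apply]
      refine L.Ppow_add_mem (L.Ppow_mono (by omega) (InP.one i j)) ?_
      rw [Matrix.mul_apply]
      exact sum_mem_Ppow _ _ _ fun c _ => L.Ppow_mul_mem (hmin c) (hN c j)
    rwa [← hA'] at h2
  have := h1.resolve_left hne
  omega

end Helpers

end LocalCSA

end Paper


open Paper Paper.LocalCSA in
/-- Let `B, C ∈ M_m(Δ_p)^•` be cancellative matrices over the unique
maximal order of the central division algebra `D_p`, with `B = C + ϖ^t M` for some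
`t ∈ ℕ` and `M ∈ M_m(Δ_p)`. If either `t > w_p(nrd B)` (i.e. `t > d·v_p(nrd B)`), or
`B` has entries in `R_p[ϖ]` and `t > v_p(nrd B)`, then `C = γB` for some
`γ ∈ M_m(Δ_p)^×`. -/
theorem local_approximation_lemma (L : LocalCSA) (mdim : ℕ)
    (B C M : Matrix (Fin mdim) (Fin mdim) L.D)
    (hB : ∀ i j, B i j ∈ L.Delta) (hC : ∀ i j, C i j ∈ L.Delta)
    (hM : ∀ i j, M i j ∈ L.Delta)
    (hBc : L.nrd B ≠ 0) (hCc : L.nrd C ≠ 0)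
    (t : ℕ) (heq : B = C + (L.ϖ ^ t) • M)
    (hcond : ((L.d : ℤ) * L.v (L.nrd B) < (t : ℤ)) ∨
      ((∀ i j, B i j ∈ Subring.closure
          ({x : L.D | ∃ y : L.Kp, (y = 0 ∨ 0 ≤ L.v y) ∧ x = algebraMap L.Kp L.D y}
            ∪ {L.ϖ})) ∧ L.v (L.nrd B) < (t : ℤ))) :
    ∃ γ : Matrix (Fin mdim) (Fin mdim) L.D,
      (∀ i j, γ i j ∈ L.Delta) ∧
      (∃ γ' : Matrix (Fin mdim) (Fin mdim) L.D,
        (∀ i j, γ' i j ∈ L.Delta) ∧ γ * γ' = 1 ∧ γ' * γ = 1) ∧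
      C = γ * B := by
  have hBnn : 0 ≤ L.v (L.nrd B) := phi_nonneg hBc hB
  have hd := L.d_pos
  have ht : L.v (L.nrd B) < (t : ℤ) := by
    rcases hcond with h | h
    · have : (1 : ℤ) ≤ L.d := by exact_mod_cast hd
      nlinarith
    · exact h.2
  obtain ⟨uB, hu⟩ := (L.nrd_unit B).1 hBc
  obtain ⟨uC, hw⟩ := (L.nrd_unit C).1 hCc
  set A : Matrix (Fin mdim) (Fin mdim) L.D := ↑uB⁻¹ with hA
  set A' : Matrix (Fin mdim) (Fin mdim) L.D := ↑uC⁻¹ with hA'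
  have hAB : A * B = 1 := by rw [hA, ← hu]; simp
  have hBA : B * A = 1 := by rw [hA, ← hu]; simp
  have hAC : A' * C = 1 := by rw [hA', ← hw]; simp
  have hCA : C * A' = 1 := by rw [hA', ← hw]; simp
  have hbound : L.InP (-L.v (L.nrd B)) A :=
    inv_bound (L.v (L.nrd B)).toNat.succ A B hAB hBA hB (by push_cast; omega)
  have hsm : L.InP t ((L.ϖ ^ t) • M) := by
    intro i j
    have h1 : L.ϖ ^ t ∈ L.Ppow t := Or.inr (by rw [w_pow' _ _ L.ϖ_ne, L.w_ϖ, mul_one])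
    have h2 : M i j ∈ L.Ppow 0 := hM i j
    simpa using L.Ppow_mul_mem h1 h2
  have hN : L.InP 1 (((L.ϖ ^ t) • M) * A) := (hsm.mul hbound).mono (by omega)
  have hγ : C * A = 1 - ((L.ϖ ^ t) • M) * A := by
    have : C = B - (L.ϖ ^ t) • M := by rw [heq]; simp
    rw [this, sub_mul, hBA]
  refine ⟨C * A, ?_, ⟨B * A', ?_, ?_, ?_⟩, ?_⟩
  · have : L.InP 0 (C * A) := by
      rw [hγ, sub_eq_add_neg]
      exact InP.one.add (hN.mono (by omega)).neg
    exact this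
  · refine inv_one_sub hN ?_
    rw [← hγ, mul_assoc, ← mul_assoc A', hAC, one_mul, hBA]
  · rw [mul_assoc, ← mul_assoc A, hAB, one_mul, hCA]
  · rw [mul_assoc, ← mul_assoc A', hAC, one_mul, hBA]
  · rw [mul_assoc, hAB, mul_one]
end

section
/- Let O = O(ñ, M) be a tiled order in standard form with ñ = (n_1,…,n_r), let l ∈ {1,…,r}, and let α ∈ O^{(l)}. Then α is an atom of the cancellative monoid O^{(l)•} if and only if α^{(k)} is an atom of O^{(k)•} for all k with l ≤ k ≤ r. -/
open scoped ENNReal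

namespace Paper.LocalCSA

/-- `a` is invertible within the multiplicatively closed subset `S`. -/
def IsUnitIn {M : Type*} [Monoid M] (S : Set M) (a : M) : Prop :=
  a ∈ S ∧ ∃ b ∈ S, a * b = 1 ∧ b * a = 1

/-- `a` is an atom of the monoid carried by the multiplicatively closed subset `S`. -/
def IsAtomIn {M : Type*} [Monoid M] (S : Set M) (a : M) : Prop :=
  a ∈ S ∧ ¬ IsUnitIn S a ∧
  ∀ b c : M, b ∈ S → c ∈ S → a = b * c → IsUnitIn S b ∨ IsUnitIn S c

/-- Indices of the first `l` blocks of the partition `ñ = (n_1, …, n_r)`. -/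
abbrev JleIdx {r : ℕ} (nv : Fin r → ℕ) (l : ℕ) : Type := {a : BlockIdx nv // (a.1 : ℕ) < l}

/-- The extension-by-the-identity map `τ_{kl} : M over O^{(l)} → M over O^{(k)}`
(identity blocks on the diagonal, zero elsewhere). -/
def extMat {r : ℕ} {nv : Fin r → ℕ} (l k : ℕ) {D : Type} [Zero D] [One D]
    (B : Matrix (JleIdx nv l) (JleIdx nv l) D) :
    Matrix (JleIdx nv k) (JleIdx nv k) D :=
  Matrix.of fun a b =>
    if ha : (a.1.1 : ℕ) < l then
      if hb : (b.1.1 : ℕ) < l then B ⟨a.1, ha⟩ ⟨b.1, hb⟩ else 0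
    else if a.1 = b.1 then 1 else 0

/-- The set underlying the cancellative monoid `O^{(l)•}` of the truncated order
`O^{(l)} = O(ñ^{(l)}, M^{(l)})`. -/
def truncDotSet (L : LocalCSA) {r : ℕ} (nv : Fin r → ℕ) (m : Fin r → Fin r → ℤ)
    (l : ℕ) : Set (Matrix (JleIdx nv l) (JleIdx nv l) L.D) :=
  {B | B ∈ L.stdSet m (fun a : JleIdx nv l => a.1.1) ∧ L.nrd B ≠ 0}

end Paper.LocalCSA

namespace Paper.LocalCSA

/-- Units transport along multiplicative equivalences. -/
lemma isUnitIn_map {M N : Type*} [Monoid M] [Monoid N] (f : M ≃* N) {S : Set M} {T : Set N}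
    (h : ∀ x, f x ∈ T ↔ x ∈ S) {a : M} : IsUnitIn T (f a) ↔ IsUnitIn S a := by
  constructor
  · rintro ⟨ha, b, hb, h1, h2⟩
    obtain ⟨b, rfl⟩ := f.surjective b
    refine ⟨(h a).1 ha, b, (h b).1 hb, f.injective ?_, f.injective ?_⟩
    · rw [map_mul, map_one, h1]
    · rw [map_mul, map_one, h2]
  · rintro ⟨ha, b, hb, h1, h2⟩
    refine ⟨(h a).2 ha, f b, (h b).2 hb, ?_, ?_⟩
    · rw [← map_mul, h1, map_one]
    · rw [← map_mul, h2, map_one]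

/-- Atoms transport along multiplicative equivalences. -/
lemma isAtomIn_map {M N : Type*} [Monoid M] [Monoid N] (f : M ≃* N) {S : Set M} {T : Set N}
    (h : ∀ x, f x ∈ T ↔ x ∈ S) {a : M} (ha : IsAtomIn S a) : IsAtomIn T (f a) := by
  obtain ⟨h1, h2, h3⟩ := ha
  refine ⟨(h a).2 h1, fun hu => h2 ((isUnitIn_map f h).1 hu), ?_⟩
  intro b c hb hc hbc
  obtain ⟨b, rfl⟩ := f.surjective b
  obtain ⟨c, rfl⟩ := f.surjective c
  rw [isUnitIn_map f h, isUnitIn_map f h]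
  refine h3 b c ((h b).1 hb) ((h c).1 hc) (f.injective ?_)
  rw [hbc, map_mul]

lemma isUnitIn_mul {M : Type*} [Monoid M] {S : Set M}
    (hS : ∀ x y, x ∈ S → y ∈ S → x * y ∈ S) {a b : M}
    (ha : IsUnitIn S a) (hb : IsUnitIn S b) : IsUnitIn S (a * b) := by
  obtain ⟨ha, a', ha', h1, h2⟩ := ha
  obtain ⟨hb, b', hb', h3, h4⟩ := hb
  refine ⟨hS _ _ ha hb, b' * a', hS _ _ hb' ha', ?_, ?_⟩
  · rw [mul_assoc, ← mul_assoc b, h3, one_mul, h1]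
  · rw [mul_assoc, ← mul_assoc a', h2, one_mul, h4]

variable (L : LocalCSA)

lemma Ppow_sum_mem {m : ℤ} {ι : Type} (s : Finset ι) (f : ι → L.D)
    (h : ∀ i ∈ s, f i ∈ L.Ppow m) : ∑ i ∈ s, f i ∈ L.Ppow m :=
  Finset.sum_induction _ (· ∈ L.Ppow m)
      (fun _ _ hx hy => L.Ppow_add_mem hx hy) (L.Ppow_zero_mem _) h

lemma eq_zero_of_Ppow {x : L.D} (h : ∀ t, x ∈ L.Ppow t) : x = 0 := by
  rcases h (L.w x + 1) with h | h
  · exact h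
  · omega

lemma exists_Ppow {ι : Type} [Fintype ι] (f : ι → L.D) : ∃ s : ℤ, ∀ i, f i ∈ L.Ppow s := by
  obtain ⟨s, hs⟩ := (Set.finite_range (fun i => L.w (f i))).bddBelow
  exact ⟨s, fun i => Or.inr (hs ⟨i, rfl⟩)⟩

/-- A solution of `y = z + x y` with `x` topologically nilpotent is as integral as `z`. -/
lemma integral_of_fixed {κ : Type} [Fintype κ] (x y z : Matrix κ κ L.D) (t : ℤ)
    (hx : ∀ a b, x a b ∈ L.Ppow 1) (hz : ∀ a b, z a b ∈ L.Ppow t) (h : y = z + x * y) :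
    ∀ a b, y a b ∈ L.Ppow t := by
  obtain ⟨s, hs⟩ := L.exists_Ppow (fun p : κ × κ => y p.1 p.2)
  have key : ∀ n : ℕ, ∀ a b, y a b ∈ L.Ppow (min t (s + n)) := by
    intro n
    induction n with
    | zero => exact fun a b => L.Ppow_mono (by simp) (hs (a, b))
    | succ n ih =>
      intro a b
      rw [h, Matrix.add_apply, Matrix.mul_apply]
      refine L.Ppow_add_mem (L.Ppow_mono (by simp) (hz a b)) (L.Ppow_sum_mem _ _ ?_)
      intro c _
      refine L.Ppow_mono ?_ (L.Ppow_mul_mem (hx a c) (ih c b))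
      push_cast
      omega
  intro a b
  refine L.Ppow_mono ?_ (key (t - s).toNat a b)
  omega

lemma one_sub_inv {κ : Type} [Fintype κ] [DecidableEq κ] (x : Matrix κ κ L.D)
    (hx : ∀ a b, x a b ∈ L.Ppow 1) :
    ∃ u : Matrix κ κ L.D, (1 - x) * u = 1 ∧ ∀ a b, u a b ∈ L.Ppow 0 := by
  have inj : Function.Injective (LinearMap.mulLeft L.Kp (1 - x)) := by
    rw [← LinearMap.ker_eq_bot, LinearMap.ker_eq_bot']
    intro y hy
    have hy' : y = 0 + x * y := by
      have : (1 - x) * y = 0 := hy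
      rw [sub_mul, one_mul, sub_eq_zero] at this
      rw [zero_add]; exact this
    ext a b
    exact L.eq_zero_of_Ppow fun t =>
      L.integral_of_fixed x y 0 t hx (fun _ _ => L.Ppow_zero_mem _) hy' a b
  obtain ⟨u, hu⟩ := LinearMap.surjective_of_injective inj 1
  have hu' : (1 - x) * u = 1 := hu
  refine ⟨u, hu', L.integral_of_fixed x u 1 0 hx ?_ ?_⟩
  · intro a b
    by_cases h : a = b
    · subst h
      simpa using L.Ppow_one_mem le_rfl
    · simpa [Matrix.one_apply_ne h] using L.Ppow_zero_mem _
  · rw [← hu', sub_mul, one_mul]; simp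

/-- Rectangular version of `stdSet`. -/
def rectSet {r : ℕ} (m : Fin r → Fin r → ℤ) {ι κ : Type} (β : ι → Fin r) (γ : κ → Fin r) :
    Set (Matrix ι κ L.D) :=
  {B | ∀ a b, B a b ∈ L.Ppow (m (β a) (γ b))}

section
variable {L}
variable {r : ℕ} {m : Fin r → Fin r → ℤ} {ι κ ν : Type} {β : ι → Fin r} {γ : κ → Fin r}
  {δ : ν → Fin r}

lemma rect_mul [Fintype κ] (htri : ∀ i j k, m i k ≤ m i j + m j k)
    {X : Matrix ι κ L.D} {Y : Matrix κ ν L.D}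
    (hX : X ∈ L.rectSet m β γ) (hY : Y ∈ L.rectSet m γ δ) : X * Y ∈ L.rectSet m β δ := by
  intro a b
  rw [Matrix.mul_apply]
  refine L.Ppow_sum_mem _ _ fun c _ => ?_
  exact L.Ppow_mono (htri _ _ _) (L.Ppow_mul_mem (hX a c) (hY c b))

lemma rect_neg {X : Matrix ι κ L.D} (hX : X ∈ L.rectSet m β γ) : -X ∈ L.rectSet m β γ :=
  fun a b => L.Ppow_neg_mem (hX a b)

lemma rect_sub {X Y : Matrix ι κ L.D} (hX : X ∈ L.rectSet m β γ) (hY : Y ∈ L.rectSet m β γ) :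
    X - Y ∈ L.rectSet m β γ := by
  intro a b
  rw [Matrix.sub_apply, sub_eq_add_neg]
  exact L.Ppow_add_mem (hX a b) (L.Ppow_neg_mem (hY a b))

lemma rect_zero : (0 : Matrix ι κ L.D) ∈ L.rectSet m β γ := fun _ _ => L.Ppow_zero_mem _

lemma rect_one [DecidableEq ι] (h0 : ∀ i, m i i = 0) :
    (1 : Matrix ι ι L.D) ∈ L.rectSet m β β := by
  intro a b
  by_cases h : a = b
  · subst h
    simpa using L.Ppow_one_mem (le_of_eq (h0 (β a)))
  · simpa [Matrix.one_apply_ne h] using L.Ppow_zero_mem _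

lemma rect_fromBlocks {A : Matrix ι ι L.D} {B : Matrix ι κ L.D} {C : Matrix κ ι L.D}
    {E : Matrix κ κ L.D} :
    Matrix.fromBlocks A B C E ∈ L.rectSet m (Sum.elim β γ) (Sum.elim β γ) ↔
      A ∈ L.rectSet m β β ∧ B ∈ L.rectSet m β γ ∧ C ∈ L.rectSet m γ β ∧
        E ∈ L.rectSet m γ γ := by
  constructor
  · intro h
    exact ⟨fun a b => h (.inl a) (.inl b), fun a b => h (.inl a) (.inr b),
      fun a b => h (.inr a) (.inl b), fun a b => h (.inr a) (.inr b)⟩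
  · rintro ⟨h1, h2, h3, h4⟩ (a | a) (b | b)
    · exact h1 a b
    · exact h2 a b
    · exact h3 a b
    · exact h4 a b
end

/-- The cancellative monoid of the order attached to a block assignment. -/
def dotSet {r : ℕ} (m : Fin r → Fin r → ℤ) {ι : Type} [Fintype ι] [DecidableEq ι]
    (β : ι → Fin r) : Set (Matrix ι ι L.D) :=
  {B | B ∈ L.rectSet m β β ∧ IsUnit B}

section
variable {L}
variable {r : ℕ} {m : Fin r → Fin r → ℤ} {ι κ : Type} [Fintype ι] [DecidableEq ι]
  [Fintype κ] [DecidableEq κ] {β : ι → Fin r} {γ : κ → Fin r}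

lemma dot_mul (htri : ∀ i j k, m i k ≤ m i j + m j k) (X Y : Matrix ι ι L.D)
    (hX : X ∈ L.dotSet m β) (hY : Y ∈ L.dotSet m β) : X * Y ∈ L.dotSet m β :=
  ⟨rect_mul htri hX.1 hY.1, hX.2.mul hY.2⟩

lemma unit_dot {X Y : Matrix ι ι L.D} (hX : X ∈ L.rectSet m β β) (hY : Y ∈ L.rectSet m β β)
    (h1 : X * Y = 1) (h2 : Y * X = 1) : IsUnitIn (L.dotSet m β) X :=
  ⟨⟨hX, ⟨⟨X, Y, h1, h2⟩, rfl⟩⟩, Y, ⟨hY, ⟨⟨Y, X, h2, h1⟩, rfl⟩⟩, h1, h2⟩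

/-- Upper triangular unit. -/
lemma unit_upper (hstd : IsStdForm m) {A : Matrix ι ι L.D} {B : Matrix ι κ L.D}
    (hA : IsUnitIn (L.dotSet m β) A) (hB : B ∈ L.rectSet m β γ) :
    IsUnitIn (L.dotSet m (Sum.elim β γ)) (Matrix.fromBlocks A B 0 1) := by
  obtain ⟨hA, P, hP, h1, h2⟩ := hA
  refine unit_dot (Y := Matrix.fromBlocks P (-(P * B)) 0 1) ?_ ?_ ?_ ?_
  · exact rect_fromBlocks.2 ⟨hA.1, hB, rect_zero, rect_one hstd.1⟩
  · exact rect_fromBlocks.2 ⟨hP.1, rect_neg (rect_mul hstd.2.1 hP.1 hB), rect_zero,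
      rect_one hstd.1⟩
  · rw [Matrix.fromBlocks_multiply]
    simp [h1, ← Matrix.mul_assoc]
  · rw [Matrix.fromBlocks_multiply]
    simp [h2]

lemma atom_block (hstd : IsStdForm m) (j : Fin r) (hγ : ∀ b, γ b = j) (hj : ∀ a, β a ≠ j)
    {α : Matrix ι ι L.D} (hα : IsAtomIn (L.dotSet m β) α) :
    IsAtomIn (L.dotSet m (Sum.elim β γ)) (Matrix.fromBlocks α 0 0 (1 : Matrix κ κ L.D)) := by
  obtain ⟨hmem, hnu, hat⟩ := hα
  have htri := hstd.2.1
  refine ⟨⟨rect_fromBlocks.2 ⟨hmem.1, rect_zero, rect_zero, rect_one hstd.1⟩, ?_⟩, ?_, ?_⟩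
  · obtain ⟨u, hu⟩ := hmem.2
    have h1 : α * (↑u⁻¹ : Matrix ι ι L.D) = 1 := by rw [← hu]; simp
    have h2 : (↑u⁻¹ : Matrix ι ι L.D) * α = 1 := by rw [← hu]; simp
    refine ⟨⟨Matrix.fromBlocks α 0 0 1, Matrix.fromBlocks (↑u⁻¹ : Matrix ι ι L.D) 0 0 1, ?_, ?_⟩, rfl⟩
    · rw [Matrix.fromBlocks_multiply]; simp [h1]
    · rw [Matrix.fromBlocks_multiply]; simp [h2]
  · rintro ⟨-, b, hb, h1, h2⟩
    rw [← Matrix.fromBlocks_toBlocks b] at hb h1 h2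
    rw [Matrix.fromBlocks_multiply, ← Matrix.fromBlocks_one, Matrix.fromBlocks_inj] at h1 h2
    have hb1 := (rect_fromBlocks.1 hb.1).1
    exact hnu (unit_dot hmem.1 hb1 (by simpa using h1.1) (by simpa using h2.1))
  · intro b c hb hc hbc
    obtain ⟨b11, b12, b21, b22, rfl⟩ : ∃ b11 b12 b21 b22, b = Matrix.fromBlocks b11 b12 b21 b22 :=
      ⟨_, _, _, _, (Matrix.fromBlocks_toBlocks b).symm⟩
    obtain ⟨c11, c12, c21, c22, rfl⟩ : ∃ c11 c12 c21 c22, c = Matrix.fromBlocks c11 c12 c21 c22 :=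
      ⟨_, _, _, _, (Matrix.fromBlocks_toBlocks c).symm⟩
    obtain ⟨hb11, hb12, hb21, hb22⟩ := rect_fromBlocks.1 hb.1
    obtain ⟨hc11, hc12, hc21, hc22⟩ := rect_fromBlocks.1 hc.1
    have hbc' := hbc
    rw [Matrix.fromBlocks_multiply, Matrix.fromBlocks_inj] at hbc'
    obtain ⟨h11, h12, h21, h22⟩ := hbc'
    have hx : ∀ a b, (b21 * c12) a b ∈ L.Ppow 1 := by
      intro a b
      rw [Matrix.mul_apply]
      refine L.Ppow_sum_mem _ _ fun i _ => ?_
      refine L.Ppow_mono ?_ (L.Ppow_mul_mem (hb21 a i) (hc12 i b))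
      rw [hγ, hγ]
      have := hstd.2.2 _ _ (hj i)
      omega
    obtain ⟨u, hu1, hu⟩ := L.one_sub_inv _ hx
    have hur : u ∈ L.rectSet m γ γ := by
      intro a b
      rw [hγ, hγ, hstd.1]
      exact hu a b
    have hv1 : b22 * (c22 * u) = 1 := by
      rw [← Matrix.mul_assoc, ← hu1, h22, add_sub_cancel_left]
    have hv : c22 * u ∈ L.rectSet m γ γ := rect_mul htri hc22 hur
    generalize c22 * u = v at hv1 hv
    have hv2 : v * b22 = 1 := mul_eq_one_comm.1 hv1
    have hE : IsUnitIn (L.dotSet m (Sum.elim β γ))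
        (Matrix.fromBlocks (1 : Matrix ι ι L.D) 0 b21 b22) := by
      refine unit_dot (Y := Matrix.fromBlocks 1 0 (-(v * b21)) v) ?_ ?_ ?_ ?_
      · exact rect_fromBlocks.2 ⟨rect_one hstd.1, rect_zero, hb21, hb22⟩
      · exact rect_fromBlocks.2 ⟨rect_one hstd.1, rect_zero, rect_neg (rect_mul htri hv hb21), hv⟩
      · rw [Matrix.fromBlocks_multiply]
        simp [hv1, ← Matrix.mul_assoc]
      · rw [Matrix.fromBlocks_multiply]
        simp [hv2]
    have hF : IsUnitIn (L.dotSet m (Sum.elim β γ))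
        (Matrix.fromBlocks (1 : Matrix ι ι L.D) 0 (-(v * b21)) v) := by
      refine unit_dot (Y := Matrix.fromBlocks 1 0 b21 b22) ?_ ?_ ?_ ?_
      · exact rect_fromBlocks.2 ⟨rect_one hstd.1, rect_zero, rect_neg (rect_mul htri hv hb21), hv⟩
      · exact rect_fromBlocks.2 ⟨rect_one hstd.1, rect_zero, hb21, hb22⟩
      · rw [Matrix.fromBlocks_multiply]
        simp [hv2]
      · rw [Matrix.fromBlocks_multiply]
        simp [hv1, ← Matrix.mul_assoc]
    have hb' : b11 - b12 * v * b21 ∈ L.rectSet m β β :=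
      rect_sub hb11 (rect_mul htri (rect_mul htri hb12 hv) hb21)
    have hbE : Matrix.fromBlocks b11 b12 b21 b22 =
        Matrix.fromBlocks (b11 - b12 * v * b21) (b12 * v) 0 1 *
          Matrix.fromBlocks 1 0 b21 b22 := by
      rw [Matrix.fromBlocks_multiply]
      simp [Matrix.mul_assoc, hv2]
    have hcF : Matrix.fromBlocks c11 c12 c21 c22 =
        Matrix.fromBlocks 1 0 (-(v * b21)) v * Matrix.fromBlocks c11 c12 0 1 := by
      have e1 : c21 = -(v * (b21 * c11)) := by
        have : b21 * c11 = -(b22 * c21) := eq_neg_of_add_eq_zero_left h21.symm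
        rw [this, Matrix.mul_neg, neg_neg, ← Matrix.mul_assoc, hv2, Matrix.one_mul]
      have e2 : c22 = -(v * (b21 * c12)) + v := by
        have : b21 * c12 = 1 - b22 * c22 := eq_sub_of_add_eq h22.symm
        rw [this, Matrix.mul_sub, ← Matrix.mul_assoc, hv2]
        simp
      rw [Matrix.fromBlocks_multiply, Matrix.fromBlocks_inj]
      simp [Matrix.mul_assoc, ← e1, ← e2]
    have hprod : α = (b11 - b12 * v * b21) * c11 := by
      have : b21 * c11 = -(b22 * c21) := eq_neg_of_add_eq_zero_left h21.symm
      rw [h11, Matrix.sub_mul, Matrix.mul_assoc _ b21, this, Matrix.mul_neg, Matrix.mul_assoc b12,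
        ← Matrix.mul_assoc v, hv2, Matrix.one_mul, sub_neg_eq_add]
    obtain ⟨w, hw⟩ := hmem.2
    have hα1 : α * (↑w⁻¹ : Matrix ι ι L.D) = 1 := by rw [← hw]; simp
    have hα2 : (↑w⁻¹ : Matrix ι ι L.D) * α = 1 := by rw [← hw]; simp
    have hub : IsUnit (b11 - b12 * v * b21) := by
      rw [hprod, mul_assoc] at hα1
      exact ⟨⟨_, _, hα1, mul_eq_one_comm.1 hα1⟩, rfl⟩
    have huc : IsUnit c11 := by
      rw [hprod, ← mul_assoc] at hα2
      exact ⟨⟨_, _, mul_eq_one_comm.1 hα2, hα2⟩, rfl⟩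
    rcases hat _ _ ⟨hb', hub⟩ ⟨hc11, huc⟩ hprod with h | h
    · left
      rw [hbE]
      exact isUnitIn_mul (dot_mul htri) (unit_upper hstd h (rect_mul htri hb12 hv)) hE
    · right
      rw [hcF]
      exact isUnitIn_mul (dot_mul htri) hF (unit_upper hstd h hc12)
end

lemma truncDotSet_eq {r : ℕ} (nv : Fin r → ℕ) (m : Fin r → Fin r → ℤ) (l : ℕ) :
    truncDotSet L nv m l = L.dotSet m (fun a : JleIdx nv l => a.1.1) := by
  ext B
  exact and_congr Iff.rfl (L.nrd_unit B)

/-- Splitting off the last block of indices. -/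
def splitIdx {r : ℕ} (nv : Fin r → ℕ) (l : ℕ) :
    JleIdx nv l ⊕ {a : BlockIdx nv // (a.1 : ℕ) = l} ≃ JleIdx nv (l + 1) where
  toFun := Sum.elim (fun a => ⟨a.1, Nat.lt_succ_of_lt a.2⟩)
    (fun a => ⟨a.1, by have := a.2; omega⟩)
  invFun a := if h : (a.1.1 : ℕ) < l then .inl ⟨a.1, h⟩
    else .inr ⟨a.1, by have := a.2; omega⟩
  left_inv := by
    rintro (a | a)
    · simp [a.2]
    · simp [a.2]
  right_inv := by
    intro a
    by_cases h : (a.1.1 : ℕ) < l <;> simp [h]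

lemma extMat_succ {r : ℕ} {nv : Fin r → ℕ} (l k : ℕ) (hlk : l ≤ k)
    (B : Matrix (JleIdx nv l) (JleIdx nv l) L.D) :
    extMat l (k + 1) B = extMat k (k + 1) (extMat l k B) := by
  ext a b
  simp only [extMat, Matrix.of_apply]
  split_ifs <;> first | rfl | omega | skip
  all_goals
    exfalso
    simp_all
    try omega

lemma extMat_self {r : ℕ} {nv : Fin r → ℕ} (l : ℕ)
    (B : Matrix (JleIdx nv l) (JleIdx nv l) L.D) : extMat l l B = B := by
  ext a b
  simp [extMat, a.2, b.2]

lemma atom_succ {r : ℕ} {nv : Fin r → ℕ} {m : Fin r → Fin r → ℤ} (hstd : IsStdForm m)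
    (k : ℕ) (hk : k < r) {α : Matrix (JleIdx nv k) (JleIdx nv k) L.D}
    (hα : IsAtomIn (truncDotSet L nv m k) α) :
    IsAtomIn (truncDotSet L nv m (k + 1)) (extMat k (k + 1) α) := by
  rw [truncDotSet_eq] at hα ⊢
  have h := atom_block (κ := {a : BlockIdx nv // (a.1 : ℕ) = k}) (γ := fun a => a.1.1) hstd
    ⟨k, hk⟩ (fun b => Fin.ext b.2) (fun a h => by
      have h1 := a.2
      have h2 : (a.1.1 : ℕ) = k := congrArg Fin.val h
      omega) hα
  have hf := isAtomIn_map
    (Matrix.reindexAlgEquiv ℤ L.D (splitIdx nv k)).toRingEquiv.toMulEquiv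
    (T := L.dotSet m (fun a : JleIdx nv (k + 1) => a.1.1)) ?_ h
  · convert hf using 1
    ext a b
    obtain ⟨a, rfl⟩ := (splitIdx nv k).surjective a
    obtain ⟨b, rfl⟩ := (splitIdx nv k).surjective b
    have e : ((Matrix.reindexAlgEquiv ℤ L.D (splitIdx nv k)).toRingEquiv.toMulEquiv
        (Matrix.fromBlocks α 0 0 1)) (splitIdx nv k a) (splitIdx nv k b) =
        Matrix.fromBlocks α 0 0 1 a b := by
      change Matrix.fromBlocks α 0 0 1 ((splitIdx nv k).symm (splitIdx nv k a))
        ((splitIdx nv k).symm (splitIdx nv k b)) = _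
      simp
    rw [e]
    rcases a with a | a <;> rcases b with b | b
    · simp [extMat, splitIdx, a.2, b.2]
    · simp [extMat, splitIdx, a.2, b.2]
    · have : a.1 ≠ b.1 := fun h => by
        have h1 := a.2
        have h2 := b.2
        rw [h] at h1
        omega
      simp [extMat, splitIdx, a.2, this]
    · simp [extMat, splitIdx, a.2, Matrix.one_apply, Subtype.ext_iff]
  · intro x
    refine and_congr ?_ ?_
    · constructor
      · intro hx a b
        have := hx (splitIdx nv k a) (splitIdx nv k b)
        change x ((splitIdx nv k).symm (splitIdx nv k a))
          ((splitIdx nv k).symm (splitIdx nv k b)) ∈ _ at this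
        rw [Equiv.symm_apply_apply, Equiv.symm_apply_apply] at this
        rcases a with a | a <;> rcases b with b | b <;> exact this
      · intro hx a b
        obtain ⟨a, rfl⟩ := (splitIdx nv k).surjective a
        obtain ⟨b, rfl⟩ := (splitIdx nv k).surjective b
        change x ((splitIdx nv k).symm (splitIdx nv k a))
          ((splitIdx nv k).symm (splitIdx nv k b)) ∈ _
        rw [Equiv.symm_apply_apply, Equiv.symm_apply_apply]
        have := hx a b
        rcases a with a | a <;> rcases b with b | b <;> exact this
    · exact MulEquiv.isUnit_map _

end Paper.LocalCSA

open Paper Paper.LocalCSA in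
/-- Let `O = O(ñ, M)` be a tiled order in standard form,
`1 ≤ l ≤ r`, and `α ∈ O^{(l)}`. Then `α` is an atom of `O^{(l)•}` if and only if
`α^{(k)} = τ_{kl}(α)` is an atom of `O^{(k)•}` for all `l ≤ k ≤ r`. -/
theorem atom_iff_extension_atom (L : LocalCSA) (r : ℕ) (nv : Fin r → ℕ)
    (hnv : ∀ i, 0 < nv i) (m : Fin r → Fin r → ℤ) (hstd : IsStdForm m)
    (l : ℕ) (hl1 : 1 ≤ l) (hl2 : l ≤ r)
    (α : Matrix (JleIdx nv l) (JleIdx nv l) L.D)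
    (hα : α ∈ truncDotSet L nv m l) :
    IsAtomIn (truncDotSet L nv m l) α ↔
    ∀ k : ℕ, l ≤ k → k ≤ r → IsAtomIn (truncDotSet L nv m k) (extMat l k α) := by
  constructor
  · intro h k hlk
    induction k, hlk using Nat.le_induction with
    | base =>
      intro _
      rw [extMat_self]
      exact h
    | succ k hlk ih =>
      intro hk
      rw [extMat_succ L l k hlk]
      exact atom_succ L hstd k hk (ih (by omega))
  · intro h
    have := h l le_rfl hl2
    rwa [extMat_self] at this
end
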